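/- For any two subsets C, C' of 𝔠, the label ⟨ℓ(C')⟩ of Σ_ℛ is at least as strong as the label ⟨ℓ(C)⟩ according to the node constraint 𝒩_ℛ of ℛ(Π) (i.e., ⟨ℓ(C)⟩ ≤ ⟨ℓ(C')⟩) if and only if C ⊆ C'. -/

import Mathlib

open scoped Classical

/-- `StrEq 𝒞 B A` : the label `A` is at least as strong as the label `B` according to the
constraint `𝒞` (written `B ≤ A`): every configuration of `𝒞` containing `B` remains a
configuration of `𝒞` after replacing one occurrence of `B` by `A`. -/
def StrEq {L : Type*} [DecidableEq L] (𝒞 : Set (Multiset L)) (B A : L) : Prop :=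
  ∀ m ∈ 𝒞, B ∈ m → (A ::ₘ m.erase B) ∈ 𝒞

/-- `IsChoice m c` : the multiset `c` is obtained by choosing one element from each of the
sets in the configuration `m`. -/
def IsChoice {L : Type*} (m : Multiset (Set L)) (c : Multiset L) : Prop :=
  Multiset.Rel (fun B a => a ∈ B) m c

/-- The hyperedge constraint ℰ_Π: the label `ℓ(C)` is identified with the color set
`C ⊆ 𝔠 = {1, …, Δ}` (here `Finset (Fin Δ)`), and a hyperedge configuration is a multiset of
`r` labels `ℓ(C₁) … ℓ(C_r)` such that for each color `i` there is at least one index `j`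
with `i ∉ C_j`. -/
def EPi (Δ r : ℕ) : Set (Multiset (Finset (Fin Δ))) :=
  {m | Multiset.card m = r ∧ ∀ i : Fin Δ, ∃ C ∈ m, i ∉ C}

/-- The node constraint 𝒩_Π: the configurations `ℓ(C)^{Δ−|C|+1} ℓ(∅)^{|C|−1}` for
nonempty `C ⊆ 𝔠`. -/
def NPi (Δ : ℕ) : Set (Multiset (Finset (Fin Δ))) :=
  {m | ∃ C : Finset (Fin Δ), C ≠ ∅ ∧
    m = Multiset.replicate (Δ - C.card + 1) C +
        Multiset.replicate (C.card - 1) (∅ : Finset (Fin Δ))}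

/-- `⟨ℓ(C)⟩`, the set of all labels at least as strong as `ℓ(C)` according to ℰ_Π. -/
def genE (Δ r : ℕ) (C : Finset (Fin Δ)) : Set (Finset (Fin Δ)) :=
  {A | StrEq (EPi Δ r) C A}

/-- Configurations `B₁ … B_r` of nonempty subsets of Σ_Π all of whose choices form
configurations of ℰ_Π. -/
def ECand (Δ r : ℕ) : Set (Multiset (Set (Finset (Fin Δ)))) :=
  {m | Multiset.card m = r ∧ (∀ B ∈ m, B.Nonempty) ∧ ∀ c, IsChoice m c → c ∈ EPi Δ r}

/-- The hyperedge constraint ℰ_ℛ of ℛ(Π): the maximal configurations among `ECand`. -/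
def ER (Δ r : ℕ) : Set (Multiset (Set (Finset (Fin Δ)))) :=
  {m | m ∈ ECand Δ r ∧ ∀ m' ∈ ECand Δ r, Multiset.Rel (· ⊆ ·) m m' → m = m'}

/-- The label set Σ_ℛ of ℛ(Π): the subsets of Σ_Π occurring in configurations of ℰ_ℛ. -/
def SigR (Δ r : ℕ) : Set (Set (Finset (Fin Δ))) :=
  {B | ∃ m ∈ ER Δ r, B ∈ m}

/-- The node constraint 𝒩_ℛ of ℛ(Π): configurations `B₁ … B_Δ` of labels of Σ_ℛ such that
some choice forms a configuration of 𝒩_Π. -/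
def NR (Δ r : ℕ) : Set (Multiset (Set (Finset (Fin Δ)))) :=
  {m | Multiset.card m = Δ ∧ (∀ B ∈ m, B ∈ SigR Δ r) ∧ ∃ c, IsChoice m c ∧ c ∈ NPi Δ}


lemma mem_genE (Δ r : ℕ) (hr : 2 ≤ r) (C A : Finset (Fin Δ)) :
    A ∈ genE Δ r C ↔ A ⊆ C := by
  constructor
  · intro h i hi
    by_contra hC
    have h1 := h (C ::ₘ Cᶜ ::ₘ Multiset.replicate (r - 2) Finset.univ) (by
      refine ⟨by simp; omega, fun j => ?_⟩
      by_cases hj : j ∈ C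
      · exact ⟨Cᶜ, by simp, by simpa using hj⟩
      · exact ⟨C, by simp, hj⟩) (by simp)
    rw [Multiset.erase_cons_head] at h1
    obtain ⟨D, hD, hiD⟩ := h1.2 i
    rw [Multiset.mem_cons, Multiset.mem_cons] at hD
    rcases hD with rfl | rfl | hD
    · exact hiD hi
    · exact hiD (by simpa using hC)
    · rw [Multiset.eq_of_mem_replicate hD] at hiD
      exact hiD (Finset.mem_univ i)
  · intro h m hm hC
    obtain ⟨t, rfl⟩ := Multiset.exists_cons_of_mem hC
    rw [Multiset.erase_cons_head]
    refine ⟨by simpa using hm.1, fun i => ?_⟩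
    obtain ⟨D, hD, hiD⟩ := hm.2 i
    rcases Multiset.mem_cons.1 hD with rfl | hD
    · exact ⟨A, by simp, fun hh => hiD (h hh)⟩
    · exact ⟨D, Multiset.mem_cons_of_mem hD, hiD⟩

lemma rel_replicate_aux {α β : Type*} (R : α → β → Prop) (a : α) (b : β) (h : R a b) (n : ℕ) :
    Multiset.Rel R (Multiset.replicate n a) (Multiset.replicate n b) := by
  induction n with
  | zero => simp
  | succ n ih => simpa [Multiset.replicate_succ] using Multiset.Rel.cons h ih

lemma genE_sig (Δ r : ℕ) (hr : 2 ≤ r) (C : Finset (Fin Δ)) : genE Δ r C ∈ SigR Δ r := by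
  refine ⟨genE Δ r C ::ₘ genE Δ r Cᶜ ::ₘ Multiset.replicate (r - 2) Set.univ,
    ⟨⟨by simp; omega, ?_, ?_⟩, ?_⟩, by simp⟩
  · intro B hB
    rw [Multiset.mem_cons, Multiset.mem_cons] at hB
    rcases hB with rfl | rfl | hB
    · exact ⟨C, (mem_genE Δ r hr _ _).2 subset_rfl⟩
    · exact ⟨Cᶜ, (mem_genE Δ r hr _ _).2 subset_rfl⟩
    · rw [Multiset.eq_of_mem_replicate hB]
      exact Set.univ_nonempty
  · intro c hc
    have hcard := Multiset.card_eq_card_of_rel hc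
    refine ⟨by rw [← hcard]; simp; omega, fun i => ?_⟩
    obtain ⟨a, t, ha, ht, rfl⟩ := Multiset.rel_cons_left.1 hc
    obtain ⟨b, t, hb, ht, rfl⟩ := Multiset.rel_cons_left.1 ht
    rw [mem_genE Δ r hr] at ha hb
    by_cases hi : i ∈ C
    · exact ⟨b, by simp, fun h => by simpa [hi] using hb h⟩
    · exact ⟨a, by simp, fun h => hi (ha h)⟩
  · intro m' hm' hrel
    obtain ⟨B1, t, h1, ht, rfl⟩ := Multiset.rel_cons_left.1 hrel
    obtain ⟨B2, t, h2, ht2, rfl⟩ := Multiset.rel_cons_left.1 ht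
    obtain ⟨hc, hall⟩ := Multiset.rel_replicate_left.1 ht2
    have htt : t = Multiset.replicate (r - 2) Set.univ :=
      Multiset.eq_replicate.2 ⟨hc, fun B hB => Set.univ_subset_iff.1 (hall B hB)⟩
    subst htt
    have key : ∀ a ∈ B1, ∀ b ∈ B2, ∀ i, i ∈ a → i ∈ b → False := by
      intro a ha b hb i hia hib
      have := hm'.2.2 (a ::ₘ b ::ₘ Multiset.replicate (r - 2) Finset.univ)
        (Multiset.Rel.cons ha (Multiset.Rel.cons hb
          (rel_replicate_aux _ _ _ (Set.mem_univ _) _)))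
      obtain ⟨D, hD, hiD⟩ := this.2 i
      rw [Multiset.mem_cons, Multiset.mem_cons] at hD
      rcases hD with rfl | rfl | hD
      · exact hiD hia
      · exact hiD hib
      · rw [Multiset.eq_of_mem_replicate hD] at hiD
        exact hiD (Finset.mem_univ i)
    have e1 : genE Δ r C = B1 := by
      refine Set.Subset.antisymm h1 fun a ha => (mem_genE Δ r hr _ _).2 fun i hi => ?_
      by_contra hC
      exact key a ha Cᶜ (h2 ((mem_genE Δ r hr _ _).2 subset_rfl)) i hi (by simpa using hC)
    have e2 : genE Δ r Cᶜ = B2 := by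
      refine Set.Subset.antisymm h2 fun a ha => (mem_genE Δ r hr _ _).2 fun i hi => ?_
      by_contra hC
      exact key C (h1 ((mem_genE Δ r hr _ _).2 subset_rfl)) a ha i (by simpa using hC) hi
    rw [e1, e2]

lemma count_le_choice {L : Type*} [DecidableEq L] (m : Multiset (Set L)) (c : Multiset L)
    (h : IsChoice m c) (D : L) : c.count D ≤ m.countP (fun B => D ∈ B) := by
  unfold IsChoice at h
  induction h with
  | zero => simp
  | @cons B a s t hab _ ih =>
    rw [Multiset.count_cons, Multiset.countP_cons]
    by_cases hD : D = a
    · subst hD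
      simp [hab, ih]
    · simp only [hD, if_false]
      omega

/-- For any two subsets `C, C'` of `𝔠`, the label `⟨ℓ(C')⟩` of Σ_ℛ is at least as strong as
`⟨ℓ(C)⟩` according to the node constraint 𝒩_ℛ of ℛ(Π) if and only if `C ⊆ C'`. -/
theorem stmt_3 (Δ r : ℕ) (hΔ : 2 ≤ Δ) (hr : 2 ≤ r) (C C' : Finset (Fin Δ)) :
    StrEq (NR Δ r) (genE Δ r C) (genE Δ r C') ↔ C ⊆ C' := by
  constructor
  · intro h i hi
    by_contra hC'
    have hpos : 0 < C.card := Finset.card_pos.2 ⟨i, hi⟩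
    have hle : C.card ≤ Δ := by simpa using Finset.card_le_univ C
    have h1 := h (Multiset.replicate (Δ - C.card + 1) (genE Δ r C) +
        Multiset.replicate (C.card - 1) (genE Δ r ∅)) (by
      refine ⟨by simp; omega, ?_, _, ?_, C, Finset.nonempty_iff_ne_empty.1 ⟨i, hi⟩, rfl⟩
      · intro B hB
        rcases Multiset.mem_add.1 hB with hB | hB <;> rw [Multiset.eq_of_mem_replicate hB] <;>
          exact genE_sig Δ r hr _
      · exact Multiset.Rel.add
          (rel_replicate_aux _ _ _ ((mem_genE Δ r hr _ _).2 subset_rfl) _)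
          (rel_replicate_aux _ _ _ ((mem_genE Δ r hr _ _).2 subset_rfl) _))
      (by simp [Multiset.replicate_succ])
    rw [Multiset.replicate_succ, Multiset.cons_add, Multiset.erase_cons_head] at h1
    obtain ⟨-, -, c, hc, D, hD, rfl⟩ := h1
    have hcount := count_le_choice _ _ hc D
    have hD0 : ¬ D ⊆ ∅ := by simpa using hD
    have hDle : D.card ≤ Δ := by simpa using Finset.card_le_univ D
    rw [Multiset.countP_cons, Multiset.countP_add, Multiset.count_add,
      Multiset.count_replicate_self] at hcount
    have r1 : ∀ (n : ℕ) (E : Finset (Fin Δ)), Multiset.countP (fun B => D ∈ B)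
        (Multiset.replicate n (genE Δ r E)) = if D ⊆ E then n else 0 := by
      intro n E
      induction n with
      | zero => simp
      | succ n ih =>
        rw [Multiset.replicate_succ, Multiset.countP_cons, ih, mem_genE Δ r hr]
        split_ifs <;> rfl
    rw [r1, r1, mem_genE Δ r hr, if_neg hD0] at hcount
    by_cases hDC : D ⊆ C
    · have hcc := Finset.card_le_card hDC
      by_cases hDC' : D ⊆ C'
      · rw [if_pos hDC, if_pos hDC'] at hcount
        have : D = C := Finset.eq_of_subset_of_card_le hDC (by omega)
        subst this
        exact hC' (hDC' hi)
      · rw [if_pos hDC, if_neg hDC'] at hcount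
        omega
    · rw [if_neg hDC] at hcount
      by_cases hDC' : D ⊆ C'
      · rw [if_pos hDC'] at hcount
        have : D = Finset.univ := by
          apply Finset.eq_univ_of_card
          rw [Fintype.card_fin]
          omega
        subst this
        exact hC' (hDC' (Finset.mem_univ i))
      · rw [if_neg hDC'] at hcount
        omega
  · intro h m hm hC
    obtain ⟨t, rfl⟩ := Multiset.exists_cons_of_mem hC
    rw [Multiset.erase_cons_head]
    obtain ⟨h1, h2, c, hc, hN⟩ := hm
    refine ⟨by simpa using h1, ?_, c, ?_, hN⟩
    · intro B hB
      rcases Multiset.mem_cons.1 hB with rfl | hB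
      · exact genE_sig Δ r hr _
      · exact h2 B (Multiset.mem_cons_of_mem hB)
    · obtain ⟨a, s, ha, hs, rfl⟩ := Multiset.rel_cons_left.1 hc
      refine Multiset.Rel.cons ?_ hs
      rw [mem_genE Δ r hr] at ha ⊢
      exact ha.trans h
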